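/- There exists a constant C0 > 0 such that for every δ > 0 there is N such that for every n ≥ N divisible by 3 and every p with n·p ≥ C0, with probability at least 1 − δ a sample G ~ 𝒢_{n,p,3} contains no nonempty subset S ⊆ V with |S| ≤ n/60 and 2·e(S) ≥ (n·p/15)·|S| (i.e., G contains no subgraph on at most n/60 vertices whose average degree is at least n·p/15). -/

import Mathlib

open MeasureTheory

/-- The balanced planted 3-coloring on `Fin n`: vertex `v` gets color `v mod 3`. -/
def plantedColoring (n : ℕ) (v : Fin n) : Fin 3 := ⟨v.val % 3, Nat.mod_lt _ (by norm_num)⟩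

/-- A pair of vertices is bichromatic if its two endpoints get distinct planted colors. -/
def Bichrom (n : ℕ) (e : Sym2 (Fin n)) : Prop :=
  Sym2.lift ⟨fun u v => plantedColoring n u ≠ plantedColoring n v,
    fun u v => propext ne_comm⟩ e

/-- The type of bichromatic pairs. -/
abbrev BichromPair (n : ℕ) : Type := {e : Sym2 (Fin n) // Bichrom n e}

noncomputable instance (n : ℕ) : Fintype (BichromPair n) := Fintype.ofFinite _

/-- The Bernoulli measure on `Bool` with parameter `p`. -/
noncomputable def bernoulliMeasure (p : ℝ) : Measure Bool :=
  ENNReal.ofReal p • Measure.dirac true + ENNReal.ofReal (1 - p) • Measure.dirac false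

/-- The planted 3-coloring distribution `𝒢_{n,p,3}`: the product over all bichromatic
pairs of Bernoulli(p) measures on `Bool`. -/
noncomputable def plantedMeasure (n : ℕ) (p : ℝ) : Measure (BichromPair n → Bool) :=
  Measure.pi fun _ => bernoulliMeasure p

/-- The graph of a sample point `ω`: its edges are the bichromatic pairs `e` with
`ω e = true`. -/
def plantedGraph (n : ℕ) (ω : BichromPair n → Bool) : SimpleGraph (Fin n) :=
  SimpleGraph.fromEdgeSet {e : Sym2 (Fin n) | ∃ h : Bichrom n e, ω ⟨e, h⟩ = true}

/-- `e(S)`: the number of edges of `G` with both endpoints in `S`. -/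
noncomputable def edgeCount {V : Type*} (G : SimpleGraph V) (S : Set V) : ℕ :=
  {e : Sym2 V | e ∈ G.edgeSet ∧ ∀ v ∈ e, v ∈ S}.ncard

/-- `D` is a `d`-core: every `v ∈ D` has at least `d/5` neighbors in `D ∩ V_i` for
each color class index `i ≠ φ*(v)`, and at most `d/20` neighbors outside `D`. -/
def IsCore (n : ℕ) (G : SimpleGraph (Fin n)) (d : ℝ) (D : Set (Fin n)) : Prop :=
  ∀ v ∈ D,
    (∀ i : Fin 3, i ≠ plantedColoring n v →
      d / 5 ≤ ({w : Fin n | G.Adj v w ∧ w ∈ D ∧ plantedColoring n w = i}.ncard : ℝ)) ∧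
    ({w : Fin n | G.Adj v w ∧ w ∉ D}.ncard : ℝ) ≤ d / 20

/-- `c_t(u,v,m)`: the number of neighbors `w` of `u` other than `v` with `m(w→u) = some t`. -/
noncomputable def msgCount {V : Type*} (G : SimpleGraph V)
    (m : V → V → Option (Fin 3)) (u v : V) (t : Fin 3) : ℕ :=
  {w : V | G.Adj u w ∧ w ≠ v ∧ m w u = some t}.ncard

/-- The smallest color minimizing `f`. -/
def argminFin3 (f : Fin 3 → ℕ) : Fin 3 :=
  if f 0 ≤ f 1 ∧ f 0 ≤ f 2 then 0 else if f 1 ≤ f 2 then 1 else 2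

open Classical in
/-- Gallager update (threshold τ = 1): `U(m)(u→v) = none` if at least two distinct colors
have count 0, otherwise the smallest color minimizing the count. -/
noncomputable def gallagerUpdate {V : Type*} (G : SimpleGraph V)
    (m : V → V → Option (Fin 3)) : V → V → Option (Fin 3) := fun u v =>
  if ∃ t₁ t₂ : Fin 3, t₁ ≠ t₂ ∧ msgCount G m u v t₁ = 0 ∧ msgCount G m u v t₂ = 0 then none
  else some (argminFin3 (msgCount G m u v))

/-- The number of neighbors `w` of `u` with `m(w→u) = some t`. -/
noncomputable def outCount {V : Type*} (G : SimpleGraph V)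
    (m : V → V → Option (Fin 3)) (u : V) (t : Fin 3) : ℕ :=
  {w : V | G.Adj u w ∧ m w u = some t}.ncard

open Classical in
/-- Output `B(u, m)` of a message state at a vertex `u`. -/
noncomputable def gallagerOutput {V : Type*} (G : SimpleGraph V)
    (m : V → V → Option (Fin 3)) (u : V) : Option (Fin 3) :=
  if ∃ t₁ t₂ : Fin 3, t₁ ≠ t₂ ∧ outCount G m u t₁ = 0 ∧ outCount G m u t₂ = 0 then none
  else some (argminFin3 (outCount G m u))

/-- The Gallager iterates: `m⁰(u→v) = some (φ u)`, `mⁱ⁺¹ = U(mⁱ)`. -/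
noncomputable def gallagerIter {V : Type*} (G : SimpleGraph V) (φ : V → Fin 3) :
    ℕ → V → V → Option (Fin 3)
  | 0 => fun u _ => some (φ u)
  | i + 1 => gallagerUpdate G (gallagerIter G φ i)

lemma isProbabilityMeasure_bernoulliMeasure {p : ℝ} (hp0 : 0 ≤ p) (hp1 : p ≤ 1) :
    IsProbabilityMeasure (bernoulliMeasure p) := by
  constructor
  simp [bernoulliMeasure, ← ENNReal.ofReal_add hp0 (sub_nonneg.2 hp1)]

lemma integral_bernoulliMeasure {p : ℝ} (hp0 : 0 ≤ p) (hp1 : p ≤ 1) (f : Bool → ℝ) :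
    ∫ b, f b ∂(bernoulliMeasure p) = p * f true + (1 - p) * f false := by
  have := isProbabilityMeasure_bernoulliMeasure hp0 hp1
  rw [integral_fintype (Integrable.of_finite)]
  simp [bernoulliMeasure, measureReal_def, hp0, sub_nonneg.2 hp1]

lemma not_isDiag_of_bichrom {n : ℕ} {e : Sym2 (Fin n)} (he : Bichrom n e) : ¬ e.IsDiag := by
  induction e with
  | _ u v =>
    rw [Sym2.mk_isDiag_iff]
    rintro rfl
    exact he rfl

open Classical in
lemma two_mul_card_bichrom_within_le {n : ℕ} (S : Finset (Fin n)) :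
    2 * (Finset.univ.filter fun e : BichromPair n => ∀ v ∈ e.1, v ∈ S).card ≤ S.card ^ 2 := by
  have h : (Finset.univ.filter fun e : BichromPair n => ∀ v ∈ e.1, v ∈ S).card ≤
      (S.offDiag.image Sym2.mk.uncurry).card := by
    refine Finset.card_le_card_of_injOn Subtype.val ?_ Subtype.val_injective.injOn
    rintro ⟨e, he⟩ hS
    induction e with
    | _ u v =>
      have hne := not_isDiag_of_bichrom he
      rw [Sym2.mk_isDiag_iff] at hne
      simp only [Finset.coe_filter, Finset.mem_univ, true_and, Set.mem_ofPred_eq] at hS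
      simp only [Finset.coe_image, Set.mem_image, Finset.mem_coe, Finset.mem_offDiag]
      exact ⟨(u, v), ⟨hS u (Sym2.mem_mk_left u v), hS v (Sym2.mem_mk_right u v), hne⟩, rfl⟩
  have h2 := Sym2.two_mul_card_image_offDiag S
  rw [Finset.offDiag_card] at h2
  have : S.card ^ 2 = S.card * S.card := sq _
  omega

open Classical in
lemma edgeCount_plantedGraph {n : ℕ} (ω : BichromPair n → Bool) (S : Set (Fin n)) :
    edgeCount (plantedGraph n ω) S =
      (Finset.univ.filter fun e : BichromPair n => (∀ v ∈ e.1, v ∈ S) ∧ ω e = true).card := by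
  rw [edgeCount, ← Set.ncard_coe_finset,
    ← Set.ncard_image_of_injective _ (Subtype.val_injective (p := Bichrom n))]
  congr 1
  ext e
  simp only [plantedGraph, SimpleGraph.edgeSet_fromEdgeSet, Set.mem_sdiff, Set.mem_ofPred_eq,
    Finset.coe_filter, Finset.mem_univ, true_and, Set.mem_image]
  constructor
  · rintro ⟨⟨⟨h, hω⟩, -⟩, hS⟩
    exact ⟨⟨e, h⟩, ⟨hS, hω⟩, rfl⟩
  · rintro ⟨⟨e, h⟩, ⟨hS, hω⟩, rfl⟩
    exact ⟨⟨⟨h, hω⟩, not_isDiag_of_bichrom h⟩, hS⟩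

lemma isProbabilityMeasure_plantedMeasure (n : ℕ) {p : ℝ} (hp0 : 0 ≤ p) (hp1 : p ≤ 1) :
    IsProbabilityMeasure (plantedMeasure n p) := by
  have := isProbabilityMeasure_bernoulliMeasure hp0 hp1
  unfold plantedMeasure
  infer_instance

lemma integral_pow_edgeCount_le {n : ℕ} {p : ℝ} (hp0 : 0 ≤ p) (hp1 : p ≤ 1)
    (S : Finset (Fin n)) {t : ℝ} (ht : 0 ≤ t) :
    ∫ ω, t ^ edgeCount (plantedGraph n ω) (S : Set (Fin n)) ∂(plantedMeasure n p) ≤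
      Real.exp (p * t * (S.card : ℝ) ^ 2 / 2) := by
  classical
  have := isProbabilityMeasure_bernoulliMeasure hp0 hp1
  have hprod (ω : BichromPair n → Bool) :
      t ^ edgeCount (plantedGraph n ω) (S : Set (Fin n)) =
        ∏ e : BichromPair n, if (∀ v ∈ e.1, v ∈ S) ∧ ω e = true then t else 1 := by
    rw [edgeCount_plantedGraph, Finset.prod_ite, Finset.prod_const, Finset.prod_const_one, mul_one]
    simp
  simp_rw [hprod, plantedMeasure]
  rw [integral_fintype_prod_eq_prod
    (fun (e : BichromPair n) (b : Bool) => if (∀ v ∈ e.1, v ∈ S) ∧ b = true then t else 1)]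
  have hfactor (e : BichromPair n) :
      ∫ b, (if (∀ v ∈ e.1, v ∈ S) ∧ b = true then t else 1) ∂(bernoulliMeasure p) ≤
        if ∀ v ∈ e.1, v ∈ S then Real.exp (p * t) else 1 := by
    rw [integral_bernoulliMeasure hp0 hp1]
    by_cases h : ∀ v ∈ e.1, v ∈ S
    · have := Real.add_one_le_exp (p * t)
      rw [if_pos ⟨h, rfl⟩, if_neg (by simp), if_pos h]
      linarith
    · simp [h]
  calc _ ≤ ∏ e : BichromPair n, if ∀ v ∈ e.1, v ∈ S then Real.exp (p * t) else 1 := by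
        refine Finset.prod_le_prod (fun e _ => integral_nonneg fun b => ?_) fun e _ => hfactor e
        dsimp only
        split_ifs <;> simp [ht]
    _ = Real.exp (p * t *
          (Finset.univ.filter fun e : BichromPair n => ∀ v ∈ e.1, v ∈ S).card) := by
        rw [Finset.prod_ite, Finset.prod_const, Finset.prod_const_one, mul_one, ← Real.exp_nat_mul,
          mul_comm]
    _ ≤ _ := by
        have h : (2 : ℝ) * (Finset.univ.filter fun e : BichromPair n => ∀ v ∈ e.1, v ∈ S).card ≤
            (S.card : ℝ) ^ 2 := mod_cast two_mul_card_bichrom_within_le S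
        rw [Real.exp_le_exp]
        nlinarith [mul_nonneg hp0 ht]

lemma measureReal_le_edgeCount_le {n : ℕ} {p : ℝ} (hp0 : 0 ≤ p) (hp1 : p ≤ 1)
    (S : Finset (Fin n)) {t : ℝ} (ht : 1 ≤ t) (m : ℝ) :
    (plantedMeasure n p).real {ω | m ≤ edgeCount (plantedGraph n ω) (S : Set (Fin n))} ≤
      Real.exp (p * t * (S.card : ℝ) ^ 2 / 2) / t ^ m := by
  have := isProbabilityMeasure_plantedMeasure n hp0 hp1
  have ht0 : 0 < t := by linarith
  rw [le_div_iff₀' (Real.rpow_pos_of_pos ht0 m)]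
  refine le_trans ?_ (integral_pow_edgeCount_le hp0 hp1 S ht0.le)
  refine le_trans ?_ (mul_meas_ge_le_integral_of_nonneg
    (Filter.Eventually.of_forall fun ω => by positivity) Integrable.of_finite (t ^ m))
  refine mul_le_mul_of_nonneg_left (measureReal_mono fun ω hω => ?_) (by positivity)
  simp only [Set.mem_ofPred_eq] at hω ⊢
  rw [← Real.rpow_natCast]
  exact Real.rpow_le_rpow_of_exponent_le ht hω

lemma choose_le_exp_mul_div_pow (n : ℕ) {k : ℕ} (hk : 1 ≤ k) :
    (n.choose k : ℝ) ≤ (Real.exp 1 * n / k) ^ k := by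
  have hk0 : (0 : ℝ) < k := by exact_mod_cast hk
  refine (Nat.choose_le_pow_div k n).trans ?_
  have h := Real.pow_div_factorial_le_exp (k : ℝ) hk0.le k
  rw [← Real.exp_one_pow, div_le_iff₀ (by positivity)] at h
  rw [div_pow, mul_pow, div_le_div_iff₀ (by positivity) (by positivity)]
  calc (n : ℝ) ^ k * (k : ℝ) ^ k ≤ n ^ k * (Real.exp 1 ^ k * k.factorial) := by gcongr
    _ = _ := by ring

lemma choose_mul_exp_div_rpow_le {n k : ℕ} {a : ℝ} (hk : 1 ≤ k) (hkn : (k : ℝ) ≤ n / 60)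
    (ha : 22 ≤ a) :
    (n.choose k : ℝ) * (Real.exp (a * k) / (n / (15 * k)) ^ (a * k)) ≤
      24 / n * (1 / 2) ^ k := by
  have hk0 : (0 : ℝ) < k := by exact_mod_cast hk
  have hn0 : (0 : ℝ) < n := by linarith
  have he := Real.exp_one_lt_d9
  have he0 := Real.exp_pos 1
  set x : ℝ := Real.exp 1 * (15 * k / n) with hx
  have hx0 : 0 < x := by positivity
  have hratio : 15 * (k : ℝ) / n ≤ 1 / 4 := by
    rw [div_le_iff₀ hn0]; linarith
  have hx1 : x ≤ 0.68 := by
    calc x ≤ 2.7182818286 * (1 / 4) := by rw [hx]; gcongr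
      _ ≤ 0.68 := by norm_num
  have htail : Real.exp (a * k) / ((n : ℝ) / (15 * k)) ^ (a * k) ≤ (x ^ 22) ^ k := by
    rw [show a * k = 1 * (a * k) by ring, Real.exp_mul, one_mul,
      ← Real.div_rpow he0.le (by positivity),
      show Real.exp 1 / ((n : ℝ) / (15 * k)) = x by rw [hx]; field_simp, ← pow_mul,
      ← Real.rpow_natCast]
    refine Real.rpow_le_rpow_of_exponent_ge hx0 (by linarith) ?_
    push_cast
    gcongr
  have hbase : Real.exp 1 * n / k * x ^ 22 ≤ x / 4 := by
    calc Real.exp 1 * n / k * x ^ 22 = 15 * Real.exp 1 ^ 2 * x ^ 20 * x := by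
          rw [show x ^ 22 = x * x ^ 20 * x by ring]
          nth_rewrite 1 [hx]
          field_simp
      _ ≤ 15 * 2.7182818286 ^ 2 * 0.68 ^ 20 * x := by gcongr
      _ ≤ x / 4 := by
          rw [div_eq_inv_mul]
          gcongr
          norm_num
  obtain ⟨j, rfl⟩ : ∃ j, k = j + 1 := ⟨k - 1, by omega⟩
  have hj : ((j + 1 : ℕ) : ℝ) ≤ 2 ^ j := by exact_mod_cast Nat.lt_two_pow_self
  calc _ ≤ (Real.exp 1 * n / (j + 1 : ℕ)) ^ (j + 1) * (x ^ 22) ^ (j + 1) := by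
        gcongr
        exact choose_le_exp_mul_div_pow n hk
    _ = (Real.exp 1 * n / (j + 1 : ℕ) * x ^ 22) ^ (j + 1) := (mul_pow _ _ _).symm
    _ ≤ (x / 4) ^ (j + 1) := by gcongr
    _ = (x / 4) ^ j * (x / 4) := pow_succ _ _
    _ ≤ (1 / 4) ^ j * (x / 4) := by gcongr; linarith
    _ ≤ (1 / 4) ^ j * (12 * (j + 1 : ℕ) / n) := by
        refine mul_le_mul_of_nonneg_left ?_ (by positivity)
        rw [hx, show Real.exp 1 * (15 * ((j + 1 : ℕ) : ℝ) / n) / 4 =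
          (15 / 4 * Real.exp 1) * (j + 1 : ℕ) / n by ring]
        gcongr
        linarith
    _ ≤ (1 / 4) ^ j * (12 * 2 ^ j / n) := by gcongr
    _ = 24 / n * (1 / 2) ^ (j + 1) := by
        rw [show (1 / 4 : ℝ) = 1 / 2 * (1 / 2) by norm_num, mul_pow, pow_succ]
        have : (1 / 2 : ℝ) ^ j * 2 ^ j = 1 := by rw [← mul_pow]; norm_num
        linear_combination (12 / n * (1 / 2) ^ j) * this

open Classical in
lemma measureReal_exists_dense_le {n : ℕ} (hn : 0 < n) {p : ℝ} (hp0 : 0 ≤ p) (hp1 : p ≤ 1)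
    (hnp : 660 ≤ n * p) :
    (plantedMeasure n p).real {ω | ∃ S : Set (Fin n), S.Nonempty ∧ (S.ncard : ℝ) ≤ (n : ℝ) / 60 ∧
      (n * p / 15) * (S.ncard : ℝ) ≤ 2 * (edgeCount (plantedGraph n ω) S : ℝ)} ≤ 48 / n := by
  have := isProbabilityMeasure_plantedMeasure n hp0 hp1
  have hn0 : (0 : ℝ) < n := by exact_mod_cast hn
  set small : Finset (Finset (Fin n)) :=
    Finset.univ.filter fun S => S.Nonempty ∧ (S.card : ℝ) ≤ (n : ℝ) / 60
  let f : ℕ → ℝ := fun k => if 1 ≤ k ∧ (k : ℝ) ≤ (n : ℝ) / 60 then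
    Real.exp (n * p / 30 * k) / (n / (15 * k)) ^ (n * p / 30 * k) else 0
  have hset (S : Finset (Fin n)) (hS : S ∈ small) :
      (plantedMeasure n p).real {ω | n * p / 30 * S.card ≤
        edgeCount (plantedGraph n ω) (S : Set (Fin n))} ≤ f S.card := by
    obtain ⟨hne, hcard⟩ := (Finset.mem_filter.1 hS).2
    have hk : 1 ≤ S.card := hne.card_pos
    have hk0 : (0 : ℝ) < S.card := by exact_mod_cast hk
    have ht : 1 ≤ (n : ℝ) / (15 * S.card) := by
      rw [le_div_iff₀ (by positivity)]; linarith
    refine (measureReal_le_edgeCount_le hp0 hp1 S ht _).trans_eq ?_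
    simp only [f, hk, hcard, and_self, if_true]
    congr 2
    field_simp
    ring
  calc _ ≤ (plantedMeasure n p).real (⋃ S ∈ small, {ω | n * p / 30 * S.card ≤
          edgeCount (plantedGraph n ω) (S : Set (Fin n))}) := by
        refine measureReal_mono ?_ (measure_ne_top _ _)
        rintro ω ⟨S, hne, hcard, hdense⟩
        lift S to Finset (Fin n) using S.toFinite
        rw [Set.ncard_coe_finset] at hcard hdense
        simp only [Set.mem_iUnion, Set.mem_ofPred_eq]
        exact ⟨S, Finset.mem_filter.2 ⟨Finset.mem_univ _, Finset.coe_nonempty.1 hne, hcard⟩,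
          by linarith⟩
    _ ≤ ∑ S ∈ small, (plantedMeasure n p).real {ω | n * p / 30 * S.card ≤
          edgeCount (plantedGraph n ω) (S : Set (Fin n))} := measureReal_biUnion_finset_le _ _
    _ ≤ ∑ S ∈ small, f S.card := Finset.sum_le_sum hset
    _ ≤ ∑ S ∈ (Finset.univ : Finset (Fin n)).powerset, f S.card := by
        refine Finset.sum_le_sum_of_subset_of_nonneg (fun S _ => by simp) fun S _ _ => ?_
        dsimp only [f]
        split_ifs <;> positivity
    _ = ∑ k ∈ Finset.range (n + 1), n.choose k * f k := by
        rw [Finset.sum_powerset_apply_card f]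
        simp
    _ ≤ ∑ k ∈ Finset.range (n + 1), 24 / (n : ℝ) * (1 / 2) ^ k := by
        refine Finset.sum_le_sum fun k _ => ?_
        by_cases h : 1 ≤ k ∧ (k : ℝ) ≤ (n : ℝ) / 60
        · simp only [f, h, and_self, if_true]
          exact choose_mul_exp_div_rpow_le h.1 h.2 (by linarith)
        · simp only [f, h, if_false, mul_zero]
          positivity
    _ = 24 / n * ∑ k ∈ Finset.range (n + 1), (1 / 2 : ℝ) ^ k := by rw [Finset.mul_sum]
    _ ≤ 24 / n * 2 := by gcongr; exact sum_geometric_two_le _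
    _ = 48 / n := by ring

/-- whp there is no nonempty subset of at most `n/60` vertices whose induced
average degree is at least `np/15`. -/
theorem no_small_dense_subgraph :
    ∃ C0 : ℝ, 0 < C0 ∧
      ∀ δ : ℝ, 0 < δ → ∃ N : ℕ,
        ∀ n : ℕ, N ≤ n → 3 ∣ n → ∀ p : ℝ, 0 ≤ p → p ≤ 1 → C0 ≤ n * p →
          ENNReal.ofReal (1 - δ) ≤
            plantedMeasure n p {ω : BichromPair n → Bool |
              ¬ ∃ S : Set (Fin n), S.Nonempty ∧ (S.ncard : ℝ) ≤ (n : ℝ) / 60 ∧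
                (n * p / 15) * (S.ncard : ℝ) ≤ 2 * (edgeCount (plantedGraph n ω) S : ℝ)} := by
  refine ⟨660, by norm_num, fun δ hδ => ⟨⌈48 / δ⌉₊ + 1, fun n hN _ p hp0 hp1 hnp => ?_⟩⟩
  have := isProbabilityMeasure_plantedMeasure n hp0 hp1
  have hn : 0 < n := by omega
  have hn0 : (0 : ℝ) < n := by exact_mod_cast hn
  have hδn : 48 / (n : ℝ) ≤ δ := by
    have h : 48 / δ ≤ n := (Nat.le_ceil _).trans (by exact_mod_cast (by omega : ⌈48 / δ⌉₊ ≤ n))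
    rw [div_le_iff₀ hδ] at h
    rw [div_le_iff₀ hn0]
    linarith
  rw [ENNReal.ofReal_le_iff_le_toReal (measure_ne_top _ _), ← measureReal_def]
  have hbad := measureReal_exists_dense_le hn hp0 hp1 hnp
  have hcompl := probReal_compl_eq_one_sub (μ := plantedMeasure n p)
    (Set.toFinite {ω : BichromPair n → Bool | ∃ S : Set (Fin n), S.Nonempty ∧
      (S.ncard : ℝ) ≤ (n : ℝ) / 60 ∧
        (n * p / 15) * (S.ncard : ℝ) ≤ 2 * (edgeCount (plantedGraph n ω) S : ℝ)}).measurableSet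
  rw [Set.compl_ofPred] at hcompl
  rw [hcompl]
  linarith
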